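/- Let δ = a12·a13·a23 ∈ SG_3 where a12 = σ1², a13 = σ2σ1²σ2⁻¹, a23 = σ2², let Z be the cyclic subgroup of SP_3 = ker π generated by δ, and let Ṽ_3 be the subgroup of SP_3 generated by a13, a23, b13 = σ2σ1τ1σ2⁻¹, b23 = σ2τ2, b12 = σ1τ1. Then Z is exactly the center of SP_3, Z ∩ Ṽ_3 = {1}, Z and Ṽ_3 together generate SP_3, and consequently SP_3 is isomorphic to the direct product ℤ × Ṽ_3. -/

import Mathlib

/-- Defining relations of the singular braid group `SG₃`, as elements of the free
group on four generators `0 ↦ σ₁`, `1 ↦ σ₂`, `2 ↦ τ₁`, `3 ↦ τ₂`. -/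
def sg3Rels : Set (FreeGroup (Fin 4)) :=
  {FreeGroup.of 0 * FreeGroup.of 2 * (FreeGroup.of 2 * FreeGroup.of 0)⁻¹,
   FreeGroup.of 1 * FreeGroup.of 3 * (FreeGroup.of 3 * FreeGroup.of 1)⁻¹,
   FreeGroup.of 0 * FreeGroup.of 1 * FreeGroup.of 0 *
     (FreeGroup.of 1 * FreeGroup.of 0 * FreeGroup.of 1)⁻¹,
   FreeGroup.of 0 * FreeGroup.of 1 * FreeGroup.of 2 *
     (FreeGroup.of 3 * FreeGroup.of 0 * FreeGroup.of 1)⁻¹,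
   FreeGroup.of 1 * FreeGroup.of 0 * FreeGroup.of 3 *
     (FreeGroup.of 2 * FreeGroup.of 1 * FreeGroup.of 0)⁻¹}

/-- The singular braid group on 3 strands. -/
abbrev SG3 : Type := PresentedGroup sg3Rels

def σ1 : SG3 := PresentedGroup.of 0
def σ2 : SG3 := PresentedGroup.of 1
def τ1 : SG3 := PresentedGroup.of 2
def τ2 : SG3 := PresentedGroup.of 3

def a12 : SG3 := σ1 ^ 2
def a13 : SG3 := σ2 * σ1 ^ 2 * σ2⁻¹
def a23 : SG3 := σ2 ^ 2
def b12 : SG3 := σ1 * τ1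
def b13 : SG3 := σ2 * σ1 * τ1 * σ2⁻¹
def b23 : SG3 := σ2 * τ2

set_option linter.unusedSimpArgs false

/-! ### Relations in `SG₃` -/

lemma sg_rel {r : FreeGroup (Fin 4)} (h : r ∈ sg3Rels) : PresentedGroup.mk sg3Rels r = 1 :=
  (QuotientGroup.eq_one_iff r).2 (Subgroup.subset_normalClosure h)

lemma sg_r1 : σ1 * τ1 = τ1 * σ1 := by
  have h := sg_rel (r := FreeGroup.of 0 * FreeGroup.of 2 * (FreeGroup.of 2 * FreeGroup.of 0)⁻¹)
    (by simp [sg3Rels])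
  rw [map_mul, map_inv, mul_inv_eq_one] at h
  exact h

lemma sg_r2 : σ2 * τ2 = τ2 * σ2 := by
  have h := sg_rel (r := FreeGroup.of 1 * FreeGroup.of 3 * (FreeGroup.of 3 * FreeGroup.of 1)⁻¹)
    (by simp [sg3Rels])
  rw [map_mul, map_inv, mul_inv_eq_one] at h
  exact h

lemma sg_r3 : σ1 * σ2 * σ1 = σ2 * σ1 * σ2 := by
  have h := sg_rel (r := FreeGroup.of 0 * FreeGroup.of 1 * FreeGroup.of 0 *
     (FreeGroup.of 1 * FreeGroup.of 0 * FreeGroup.of 1)⁻¹)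
    (by simp [sg3Rels])
  rw [map_mul, map_inv, mul_inv_eq_one] at h
  exact h

lemma sg_r4 : σ1 * σ2 * τ1 = τ2 * σ1 * σ2 := by
  have h := sg_rel (r := FreeGroup.of 0 * FreeGroup.of 1 * FreeGroup.of 2 *
     (FreeGroup.of 3 * FreeGroup.of 0 * FreeGroup.of 1)⁻¹)
    (by simp [sg3Rels])
  rw [map_mul, map_inv, mul_inv_eq_one] at h
  exact h

lemma sg_r5 : σ2 * σ1 * τ2 = τ1 * σ2 * σ1 := by
  have h := sg_rel (r := FreeGroup.of 1 * FreeGroup.of 0 * FreeGroup.of 3 *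
     (FreeGroup.of 2 * FreeGroup.of 1 * FreeGroup.of 0)⁻¹)
    (by simp [sg3Rels])
  rw [map_mul, map_inv, mul_inv_eq_one] at h
  exact h

/-- Universal property of `SG₃`. -/
lemma sg_exists_hom {H : Type*} [Group H] (s1 s2 t1 t2 : H)
    (h1 : s1 * t1 = t1 * s1) (h2 : s2 * t2 = t2 * s2)
    (h3 : s1 * s2 * s1 = s2 * s1 * s2) (h4 : s1 * s2 * t1 = t2 * s1 * s2)
    (h5 : s2 * s1 * t2 = t1 * s2 * s1) :
    ∃ F : SG3 →* H, F σ1 = s1 ∧ F σ2 = s2 ∧ F τ1 = t1 ∧ F τ2 = t2 := by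
  have key : ∀ r ∈ sg3Rels, FreeGroup.lift ![s1, s2, t1, t2] r = 1 := by
    intro r hr
    simp only [sg3Rels, Set.mem_insert_iff, Set.mem_singleton_iff] at hr
    rcases hr with rfl | rfl | rfl | rfl | rfl <;>
      rw [map_mul, map_inv, mul_inv_eq_one] <;> simpa
  refine ⟨PresentedGroup.toGroup key, ?_, ?_, ?_, ?_⟩ <;>
    (first | exact PresentedGroup.toGroup.of key)

lemma sg_top_le (K : Subgroup SG3) (h1 : σ1 ∈ K) (h2 : σ2 ∈ K) (h3 : τ1 ∈ K) (h4 : τ2 ∈ K)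
    (g : SG3) : g ∈ K := by
  refine PresentedGroup.generated_by sg3Rels K ?_ g
  intro j
  fin_cases j
  exacts [h1, h2, h3, h4]

lemma sg_hom_ext {H : Type*} [Group H] (F F' : SG3 →* H) (h1 : F σ1 = F' σ1)
    (h2 : F σ2 = F' σ2) (h3 : F τ1 = F' τ1) (h4 : F τ2 = F' τ2) : F = F' := by
  ext j
  fin_cases j
  exacts [h1, h2, h3, h4]

/-! ### The Garside element and its square -/

lemma garside_s1 : σ1 * σ2 * σ1 * σ1 = σ2 * (σ1 * σ2 * σ1) := by
  nth_rw 1 [sg_r3]; simp only [mul_assoc]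

lemma garside_s2 : σ1 * σ2 * σ1 * σ2 = σ1 * (σ1 * σ2 * σ1) := by
  nth_rw 1 [mul_assoc, mul_assoc]
  rw [← mul_assoc σ2, ← sg_r3]

lemma garside_t1 : σ1 * σ2 * σ1 * τ1 = τ2 * (σ1 * σ2 * σ1) := by
  rw [mul_assoc, sg_r1, ← mul_assoc, sg_r4]; simp only [mul_assoc]

lemma garside_t2 : σ1 * σ2 * σ1 * τ2 = τ1 * (σ1 * σ2 * σ1) := by
  rw [sg_r3, mul_assoc, sg_r2, ← mul_assoc, sg_r5]; simp only [mul_assoc]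

lemma delta_eq : a12 * a13 * a23 = (σ1 * σ2 * σ1) * (σ1 * σ2 * σ1) := by
  have : a12 * a13 * a23 = σ1 * (σ1 * σ2 * σ1) * σ1 * σ2 := by
    simp only [a12, a13, a23, pow_two, mul_inv_rev, mul_assoc, inv_mul_cancel_left,
        mul_inv_cancel_left, mul_inv_cancel, inv_mul_cancel, mul_one, inv_inv]
  rw [this, ← garside_s2]
  simp only [mul_assoc]
  congr 3
  simpa only [mul_assoc] using sg_r3.symm

lemma delta_central (g : SG3) : a12 * a13 * a23 * g = g * (a12 * a13 * a23) := by
  have key : ∀ {D x y : SG3}, D * x = y * D → D * y = x * D → D * D * x = x * (D * D) := by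
    intro D x y h h'
    rw [mul_assoc, h, ← mul_assoc, h', mul_assoc]
  have hm : g ∈ Subgroup.centralizer {a12 * a13 * a23} := by
    apply sg_top_le <;> rw [Subgroup.mem_centralizer_singleton_iff, delta_eq] <;>
      first
      | exact (key garside_s1 garside_s2).symm
      | exact (key garside_s2 garside_s1).symm
      | exact (key garside_t1 garside_t2).symm
      | exact (key garside_t2 garside_t1).symm
  rw [Subgroup.mem_centralizer_singleton_iff] at hm
  first | exact hm | exact hm.symm

/-! ### Centralizer of the stable letter in an HNN extension -/

open HNNExtension in
lemma hnn_centralizer {G : Type*} [Group G] (A : Subgroup G)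
    (C : Subgroup (HNNExtension G A A (MulEquiv.refl A)))
    (hA : ∀ a ∈ A, (of a : HNNExtension G A A (MulEquiv.refl A)) ∈ C) (ht : t ∈ C)
    (x : HNNExtension G A A (MulEquiv.refl A)) (hx : t * x = x * t) : x ∈ C := by
  have hAt : ∀ a ∈ A, t * (of a : HNNExtension G A A (MulEquiv.refl A)) = of a * t :=
    fun a ha => t_mul_of (⟨a, ha⟩ : A)
  have hts : ∀ u : ℤˣ, toSubgroup A A u = A := by
    intro u; simp [toSubgroup]
  -- every element is the product of a reduced word
  obtain ⟨d⟩ := NormalWord.TransversalPair.nonempty G A A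
  obtain ⟨h, l, hc, rfl⟩ : ∃ (h : G) (l : List (ℤˣ × G)),
      l.IsChain (fun a b => a.2 ∈ A → a.1 = b.1) ∧
      x = of h * (l.map (fun y => t ^ (y.1 : ℤ) * of y.2)).prod := by
    let w := NormalWord.equiv (MulEquiv.refl A) d x
    refine ⟨w.head, w.toList, ?_, ?_⟩
    · simpa only [hts] using w.chain
    · exact ((NormalWord.equiv (MulEquiv.refl A) d).symm_apply_apply x).symm
  have len : ∀ (h h' : G) (l l' : List (ℤˣ × G)),
      l.IsChain (fun a b => a.2 ∈ A → a.1 = b.1) →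
      l'.IsChain (fun a b => a.2 ∈ A → a.1 = b.1) →
      (of h * (l.map (fun y => t ^ (y.1 : ℤ) * of y.2)).prod :
        HNNExtension G A A (MulEquiv.refl A)) =
        of h' * (l'.map (fun y => t ^ (y.1 : ℤ) * of y.2)).prod →
      l.length = l'.length := by
    intro h h' l l' hl hl' e
    have := (ReducedWord.map_fst_eq_and_of_prod_eq (MulEquiv.refl A)
      (w₁ := ⟨h, l, by simpa only [hts] using hl⟩)
      (w₂ := ⟨h', l', by simpa only [hts] using hl'⟩) e).1
    simpa using congrArg List.length this
  induction l using List.reverseRecOn with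
  | nil =>
    by_cases hh : h ∈ A
    · simpa using hA h hh
    · exfalso
      have := len 1 h [(1, h), (-1, 1)] [] (by simp [hh]) (by simp) (by
        simp only [List.map_nil, List.prod_nil, mul_one] at hx
        simp [hx])
      simp at this
  | append_singleton l p ih =>
    obtain ⟨u, g⟩ := p
    by_cases hg : g ∈ A
    · set X := (of h * (l.map (fun y => t ^ (y.1 : ℤ) * of y.2)).prod :
        HNNExtension G A A (MulEquiv.refl A)) with hX
      have e : (of h * ((l ++ [(u, g)]).map (fun y => t ^ (y.1 : ℤ) * of y.2)).prod :
        HNNExtension G A A (MulEquiv.refl A)) = X * (t ^ (u : ℤ) * of g) := by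
        simp [hX, mul_assoc]
      rw [e] at hx ⊢
      have hcm : Commute t (t ^ (u : ℤ) * of g : HNNExtension G A A (MulEquiv.refl A)) :=
        ((Commute.refl t).zpow_right _).mul_right (hAt g hg)
      have hXt : Commute t X := by
        have h1 : Commute t (X * (t ^ (u : ℤ) * of g)) := hx
        have h2 := h1.mul_right hcm.inv_right
        simpa only [mul_inv_cancel_right] using h2
      exact C.mul_mem (ih (List.IsChain.left_of_append hc) hXt)
        (C.mul_mem (C.zpow_mem ht _) (hA g hg))
    · exfalso
      set L := l ++ [(u, g)] with hL
      have hne : L ≠ [] := by simp [hL]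
      obtain ⟨e, he⟩ : ∃ e, e = (L.head hne).1 := ⟨_, rfl⟩
      have hlast : ∀ y ∈ L.getLast?, y = (u, g) := by
        intro y hy; simp [hL] at hy; exact hy.symm
      have hchain : ((e, h) :: (L ++ [(-e, 1)])).IsChain (fun a b => a.2 ∈ A → a.1 = b.1) := by
        rw [List.isChain_cons]
        constructor
        · intro y hy _
          rw [List.head?_append_of_ne_nil _ hne, List.head?_eq_some_head hne] at hy
          rw [he]; simp at hy; rw [hy]
        · rw [List.isChain_append]
          refine ⟨hc, by simp, ?_⟩
          intro y hy z _ hyA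
          rw [hlast y hy] at hyA
          exact absurd hyA hg
      have := len 1 h _ L hchain hc (by
        have hcm : Commute (t ^ (e : ℤ)) (of h * (L.map (fun y => t ^ (y.1 : ℤ) * of y.2)).prod :
          HNNExtension G A A (MulEquiv.refl A)) := Commute.zpow_left hx _
        have h3 := hcm.eq
        simp only [List.map_cons, List.map_append, List.prod_cons, List.prod_append,
          List.map_nil, List.prod_nil, map_one, one_mul, mul_one, Units.val_neg, zpow_neg]
        rw [mul_assoc, ← mul_assoc (of h), ← mul_assoc, h3, mul_inv_cancel_right])
      simp at this
      omega

lemma central_mem (C : Subgroup SG3) (h1 : σ1 ∈ C) (h2 : a12 * a13 * a23 ∈ C) (h3 : b12 ∈ C)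
    (g : SG3) (hg : b12 * g = g * b12) : g ∈ C := by
  let A : Subgroup SG3 := Subgroup.closure {σ1, a12 * a13 * a23}
  let E := HNNExtension SG3 A A (MulEquiv.refl A)
  have hs : σ1 ∈ A := Subgroup.subset_closure (by simp)
  have hd : a12 * a13 * a23 ∈ A := Subgroup.subset_closure (by simp)
  let i : SG3 →* E := HNNExtension.of
  let t : E := HNNExtension.t
  have hit : ∀ a ∈ A, t * i a = i a * t := fun a ha => HNNExtension.t_mul_of (⟨a, ha⟩ : A)
  have c1 : Commute (i σ1) t := (hit _ hs).symm
  have c2 : Commute (i σ2 * i σ1 * (i σ1 * i σ2)) t := by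
    have e : i σ2 * i σ1 * (i σ1 * i σ2) = i (σ1⁻¹ * (a12 * a13 * a23) * σ1⁻¹) := by
      rw [← map_mul, ← map_mul, ← map_mul, delta_eq]
      congr 1
      group
    rw [e]
    exact (hit _ (A.mul_mem (A.mul_mem (A.inv_mem hs) hd) (A.inv_mem hs))).symm
  have r3 : i σ1 * i σ2 * i σ1 = i σ2 * i σ1 * i σ2 := by
    simp only [← map_mul, sg_r3]
  obtain ⟨F, F1, F2, F3, F4⟩ : ∃ F : SG3 →* E, F σ1 = i σ1 ∧ F σ2 = i σ2 ∧
      F τ1 = (i σ1)⁻¹ * t ∧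
      F τ2 = (i σ1 * i σ2) * ((i σ1)⁻¹ * t) * (i σ1 * i σ2)⁻¹ := by
    have c3 : Commute (i σ1) ((i σ1)⁻¹ * t) := ((Commute.refl _).inv_right).mul_right c1
    have conj : (i σ1 * i σ2) * i σ1 * (i σ1 * i σ2)⁻¹ = i σ2 := by
      rw [r3]; group
    have c4 : Commute (i σ2 * i σ1 * (i σ1 * i σ2)) ((i σ1)⁻¹ * t) := by
      refine Commute.mul_right (Commute.inv_right ?_) c2
      show _ = _
      calc i σ2 * i σ1 * (i σ1 * i σ2) * i σ1 = i σ2 * i σ1 * (i σ1 * i σ2 * i σ1) := by group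
        _ = (i σ2 * i σ1 * i σ2) * i σ1 * i σ2 := by rw [r3]; group
        _ = _ := by rw [← r3]; group
    apply sg_exists_hom
    · exact c3
    · have := c3.eq
      generalize (i σ1)⁻¹ * t = x at *
      calc i σ2 * (i σ1 * i σ2 * x * (i σ1 * i σ2)⁻¹)
          = (i σ1 * i σ2) * i σ1 * (i σ1 * i σ2)⁻¹ *
            (i σ1 * i σ2 * x * (i σ1 * i σ2)⁻¹) := by rw [conj]
        _ = (i σ1 * i σ2) * (i σ1 * x) * (i σ1 * i σ2)⁻¹ := by group
        _ = (i σ1 * i σ2 * x * (i σ1 * i σ2)⁻¹) *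
            ((i σ1 * i σ2) * i σ1 * (i σ1 * i σ2)⁻¹) := by rw [this]; group
        _ = _ := by rw [conj]
    · exact r3
    · group
    · have := c4.eq
      generalize (i σ1)⁻¹ * t = x at *
      calc i σ2 * i σ1 * (i σ1 * i σ2 * x * (i σ1 * i σ2)⁻¹)
          = (i σ2 * i σ1 * (i σ1 * i σ2) * x) * (i σ1 * i σ2)⁻¹ := by group
        _ = _ := by rw [this]; group
  have hb : ∀ a ∈ A, b12 * a = a * b12 := by
    intro a ha
    have : A ≤ Subgroup.centralizer {b12} := by
      rw [Subgroup.closure_le]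
      rintro y (rfl | hy)
      · rw [SetLike.mem_coe, Subgroup.mem_centralizer_singleton_iff]
        simp only [b12]
        simp only [mul_assoc, ← sg_r1]
      · rw [Set.mem_singleton_iff] at hy
        subst hy
        rw [SetLike.mem_coe, Subgroup.mem_centralizer_singleton_iff]
        first | exact delta_central _ | exact (delta_central _).symm
    have h := Subgroup.mem_centralizer_singleton_iff.1 (this ha)
    first | exact h | exact h.symm
  let B : E →* SG3 := HNNExtension.lift (MonoidHom.id SG3) b12 (fun a => hb a a.2)
  have Bi : ∀ y, B (i y) = y := fun y => HNNExtension.lift_of _ _ _ y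
  have Bt : B t = b12 := HNNExtension.lift_t _ _ _
  have hBF : B.comp F = MonoidHom.id SG3 := by
    apply sg_hom_ext
    · simp [F1, Bi]
    · simp [F2, Bi]
    · simp [F3, Bi, Bt, b12]
    · simp only [MonoidHom.comp_apply, F4, map_mul, map_inv, Bi, Bt, b12, inv_mul_cancel_left,
        MonoidHom.id_apply]
      rw [sg_r4]; group
  have hBFg : ∀ y, B (F y) = y := fun y => DFunLike.congr_fun hBF y
  have hFb : F b12 = t := by simp [b12, F1, F3]
  have hm : F g ∈ C.comap B := by
    apply hnn_centralizer A
    · intro a ha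
      show B (i a) ∈ C
      rw [Bi]
      have : A ≤ C := by
        rw [Subgroup.closure_le]
        rintro y (rfl | hy)
        · exact h1
        · rw [Set.mem_singleton_iff] at hy
          subst hy; exact h2
      exact this ha
    · show B t ∈ C
      rw [Bt]; exact h3
    · have := congrArg F hg
      rw [map_mul, map_mul, hFb] at this
      exact this
  have := Subgroup.mem_comap.1 hm
  rwa [hBFg] at this

/-! ### Matrix representations -/

/-- Upper unipotent matrix. -/
def matU : Matrix.SpecialLinearGroup (Fin 2) ℤ := ⟨!![1, 1; 0, 1], by simp⟩

/-- Lower unipotent matrix. -/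
def matL : Matrix.SpecialLinearGroup (Fin 2) ℤ := ⟨!![1, 0; -1, 1], by simp⟩

lemma matU_zpow (n : ℤ) : ((matU ^ n : Matrix.SpecialLinearGroup (Fin 2) ℤ) :
    Matrix (Fin 2) (Fin 2) ℤ) = !![1, n; 0, 1] := ModularGroup.coe_T_zpow n

lemma matU_braid : matU * matL * matU = matL * matU * matL := by decide

lemma matU_comm (n : ℤ) (h : matU ^ n * matL ^ 2 = matL ^ 2 * matU ^ n) : n = 0 := by
  have h2 := congrArg (fun M : Matrix.SpecialLinearGroup (Fin 2) ℤ =>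
    (M : Matrix (Fin 2) (Fin 2) ℤ) 0 0) h
  simp only [Matrix.SpecialLinearGroup.coe_mul, matU_zpow, pow_two] at h2
  simp [Matrix.mul_apply, Fin.sum_univ_two, matL] at h2
  omega

lemma exists_rep (e : ℤ) : ∃ F : SG3 →* Matrix.SpecialLinearGroup (Fin 2) ℤ,
    F σ1 = matU ∧ F σ2 = matL ∧ F b12 = matU ^ (1 + e) := by
  have conj : (matU * matL) * matU * (matU * matL)⁻¹ = matL := by
    rw [matU_braid]; group
  have conj' : (matL * matU) * matL * (matL * matU)⁻¹ = matU := by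
    rw [← matU_braid]; group
  obtain ⟨F, F1, F2, F3, -⟩ := sg_exists_hom matU matL (matU ^ e) (matL ^ e)
    (((Commute.refl matU).zpow_right e).eq) (((Commute.refl matL).zpow_right e).eq)
    matU_braid
    (by
      have : matL ^ e = (matU * matL) * matU ^ e * (matU * matL)⁻¹ := by
        rw [← conj_zpow, conj]
      rw [this]; group)
    (by
      have : matU ^ e = (matL * matU) * matL ^ e * (matL * matU)⁻¹ := by
        rw [← conj_zpow, conj']
      rw [this]; group)
  exact ⟨F, F1, F2, by rw [b12, map_mul, F1, F3, zpow_add, zpow_one]⟩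

lemma central_mem_zpowers (g : SG3) (h1 : b12 * g = g * b12) (h2 : a23 * g = g * a23) :
    g ∈ Subgroup.zpowers (a12 * a13 * a23) := by
  have hsb : Commute σ1 b12 := by
    show _ = _
    simp only [b12, mul_assoc, ← sg_r1]
  have hmd : ∀ y : SG3, Commute (a12 * a13 * a23) y := fun y => delta_central y
  have hm : ∃ i k j : ℤ, g = σ1 ^ i * b12 ^ k * (a12 * a13 * a23) ^ j := by
    let C : Subgroup SG3 :=
      { carrier := {g | ∃ i k j : ℤ, g = σ1 ^ i * b12 ^ k * (a12 * a13 * a23) ^ j}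
        one_mem' := ⟨0, 0, 0, by simp⟩
        mul_mem' := by
          rintro _ _ ⟨i, k, j, rfl⟩ ⟨i', k', j', rfl⟩
          refine ⟨i + i', k + k', j + j', ?_⟩
          generalize a12 * a13 * a23 = d at *
          have e1 := ((hmd (σ1 ^ i' * b12 ^ k')).zpow_left j).eq
          have e2 := (hsb.zpow_zpow i' k).eq
          calc σ1 ^ i * b12 ^ k * d ^ j * (σ1 ^ i' * b12 ^ k' * d ^ j')
              = σ1 ^ i * b12 ^ k * (d ^ j * (σ1 ^ i' * b12 ^ k')) * d ^ j' := by
                simp only [mul_assoc]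
            _ = σ1 ^ i * (b12 ^ k * σ1 ^ i') * b12 ^ k' * d ^ j * d ^ j' := by
                rw [e1]; simp only [mul_assoc]
            _ = _ := by
                rw [← e2]; simp only [zpow_add, mul_assoc]
        inv_mem' := by
          rintro _ ⟨i, k, j, rfl⟩
          refine ⟨-i, -k, -j, ?_⟩
          generalize a12 * a13 * a23 = d at *
          have e1 := ((hmd (σ1 ^ (-i) * b12 ^ (-k))).zpow_left (-j)).eq
          have e2 := (hsb.zpow_zpow (-i) (-k)).eq
          rw [← e1, e2]
          simp only [mul_inv_rev, zpow_neg] }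
    refine central_mem C ⟨1, 0, 0, by simp⟩ ⟨0, 0, 1, by simp⟩ ⟨0, 1, 0, by simp⟩ g h1
  obtain ⟨i, k, j, hg⟩ := hm
  have key : ∀ e : ℤ, i + (1 + e) * k = 0 := by
    intro e
    obtain ⟨F, F1, F2, F3⟩ := exists_rep e
    apply matU_comm
    have h3 : (σ1 ^ i * b12 ^ k) * a23 = a23 * (σ1 ^ i * b12 ^ k) := by
      have e1 := ((hmd a23).zpow_left (-j)).eq
      have : σ1 ^ i * b12 ^ k = g * (a12 * a13 * a23) ^ (-j) := by
        rw [hg, mul_assoc, ← zpow_add]; simp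
      rw [this, mul_assoc, e1, ← mul_assoc, ← h2, mul_assoc]
    have h4 := congrArg F h3
    simp only [map_mul, map_zpow, F1, F3, a23, map_pow, F2, ← zpow_mul, ← zpow_add] at h4
    exact h4
  have k1 := key (-1)
  have k2 := key 0
  have hi : i = 0 := by simpa using k1
  have hk : k = 0 := by simpa [hi] using k2
  exact ⟨j, by simp [hg, hi, hk]⟩

/-! ### The linking number representation -/

/-- A permutation of `Fin 3 × ℤ` swapping the fibres over `b` and `c`, and shifting the fibre
over `a` by `n`. -/
def shiftPerm (f : Equiv.Perm (Fin 3)) (a : Fin 3) (ha : f a = a) (n : ℤ) :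
    Equiv.Perm (Fin 3 × ℤ) where
  toFun p := (f p.1, if p.1 = a then p.2 + n else p.2)
  invFun p := (f.symm p.1, if p.1 = a then p.2 - n else p.2)
  left_inv := by
    rintro ⟨x, m⟩
    have : f x = a ↔ x = a := ⟨fun h => f.injective (h.trans ha.symm), fun h => by rw [h, ha]⟩
    by_cases hx : x = a
    · have h2 : f.symm a = a := by rw [Equiv.symm_apply_eq, ha]
      simp [hx, ha, h2]
    · simp [this, hx]
  right_inv := by
    rintro ⟨x, m⟩
    have : f.symm x = a ↔ x = a := by rw [Equiv.symm_apply_eq, ha]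
    by_cases hx : x = a
    · have h2 := this.2 hx
      subst hx
      simp [h2, ha]
    · simp [this, hx]

/-- Action of a crossing of the first two strands. -/
def lk1 (n : ℤ) : Equiv.Perm (Fin 3 × ℤ) := shiftPerm (Equiv.swap 0 1) 2 (by decide) n

/-- Action of a crossing of the last two strands. -/
def lk2 (n : ℤ) : Equiv.Perm (Fin 3 × ℤ) := shiftPerm (Equiv.swap 1 2) 0 (by decide) n

lemma lk1_0 (n m : ℤ) : lk1 n (0, m) = (1, m) := rfl
lemma lk1_1 (n m : ℤ) : lk1 n (1, m) = (0, m) := rfl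
lemma lk1_2 (n m : ℤ) : lk1 n (2, m) = (2, m + n) := rfl
lemma lk2_0 (n m : ℤ) : lk2 n (0, m) = (0, m + n) := rfl
lemma lk2_1 (n m : ℤ) : lk2 n (1, m) = (2, m) := rfl
lemma lk2_2 (n m : ℤ) : lk2 n (2, m) = (1, m) := rfl

lemma exists_linking : ∃ F : SG3 →* Equiv.Perm (Fin 3 × ℤ),
    F σ1 = lk1 1 ∧ F σ2 = lk2 1 ∧ F τ1 = lk1 (-1) ∧ F τ2 = lk2 (-1) := by
  apply sg_exists_hom <;>
  · apply Equiv.ext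
    rintro ⟨x, m⟩
    fin_cases x <;>
      simp [Equiv.Perm.mul_apply, lk1_0, lk1_1, lk1_2, lk2_0, lk2_1, lk2_2]

lemma linking_trivial (n : ℤ)
    (h : (a12 * a13 * a23) ^ n ∈ Subgroup.closure {a13, a23, b13, b23, b12}) : n = 0 := by
  obtain ⟨F, F1, F2, F3, F4⟩ := exists_linking
  have hi : ∀ m : ℤ, (lk2 1)⁻¹ (2, m) = (1, m) := by
    intro m; rw [Equiv.Perm.inv_eq_iff_eq]; rfl
  have hi : ∀ m : ℤ, (lk2 1).symm (2, m) = (1, m) := hi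
  have hV : ∀ g ∈ Subgroup.closure {a13, a23, b13, b23, b12}, F g (2, 0) = (2, 0) := by
    intro g hg
    induction hg using Subgroup.closure_induction with
    | mem x hx =>
      simp only [Set.mem_insert_iff, Set.mem_singleton_iff] at hx
      rcases hx with rfl | rfl | rfl | rfl | rfl <;>
        simp [a13, a23, b13, b23, b12, F1, F2, F3, F4, pow_two, Equiv.Perm.mul_apply, hi,
          lk1_0, lk1_1, lk1_2, lk2_0, lk2_1, lk2_2]
    | one => simp
    | mul x y _ _ hx hy => rw [map_mul, Equiv.Perm.mul_apply, hy, hx]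
    | inv x _ hx => rw [map_inv, Equiv.Perm.inv_eq_iff_eq, hx]
  have hd : ∀ m : ℤ, F (a12 * a13 * a23) (2, m) = (2, m + 2) := by
    intro m
    simp [a12, a13, a23, F1, F2, pow_two, Equiv.Perm.mul_apply, hi,
          lk1_0, lk1_1, lk1_2, lk2_0, lk2_1, lk2_2]
    ring
  have hdn : ∀ k m : ℤ, F ((a12 * a13 * a23) ^ k) (2, m) = (2, m + 2 * k) := by
    intro k
    induction k using Int.induction_on with
    | zero => simp
    | succ k ih =>
      intro m
      rw [zpow_add_one, map_mul, Equiv.Perm.mul_apply, hd, ih]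
      congr 1; ring
    | pred k ih =>
      intro m
      have := ih (m - 2)
      have e : (a12 * a13 * a23) ^ (-(k : ℤ)) =
        (a12 * a13 * a23) ^ (-(k : ℤ) - 1) * (a12 * a13 * a23) := by
        rw [← zpow_add_one]; congr 1; ring
      rw [e, map_mul, Equiv.Perm.mul_apply, hd] at this
      rw [sub_add_cancel] at this
      rw [this]
      congr 1; ring
  have h1 := hV _ h
  rw [hdn, Prod.mk.injEq] at h1
  omega

/-! ### Generation of the kernel -/

lemma b23_eq : b23 = σ1 * σ2 * b12 * (σ1 * σ2)⁻¹ := by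
  have h : σ1 * σ2 * b12 * (σ1 * σ2)⁻¹ = (σ1 * σ2 * σ1) * (σ1 * σ2)⁻¹ *
      ((σ1 * σ2 * τ1) * (σ1 * σ2)⁻¹) := by simp only [b12]; group
  rw [h, sg_r3, sg_r4, b23]; group

lemma a23_eq : a23 = σ1 * σ2 * a12 * (σ1 * σ2)⁻¹ := by
  have h : σ1 * σ2 * a12 * (σ1 * σ2)⁻¹ = (σ1 * σ2 * σ1) * (σ1 * σ2)⁻¹ *
      ((σ1 * σ2 * σ1) * (σ1 * σ2)⁻¹) := by simp only [a12, pow_two, mul_inv_rev, mul_assoc, inv_mul_cancel_left,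
        mul_inv_cancel_left, mul_inv_cancel, inv_mul_cancel, mul_one, inv_inv]
  rw [h, sg_r3, a23]; simp only [pow_two, mul_inv_rev, mul_assoc, inv_mul_cancel_left,
        mul_inv_cancel_left, mul_inv_cancel, inv_mul_cancel, mul_one, inv_inv]

/-- The subgroup generated by all the `aᵢⱼ`, `bᵢⱼ`. -/
def subN : Subgroup SG3 := Subgroup.closure {a12, a13, a23, b12, b13, b23}

lemma subN_conj (s : SG3) (h : ∀ x ∈ ({a12, a13, a23, b12, b13, b23} : Set SG3),
    s * x * s⁻¹ ∈ subN) (n : SG3) (hn : n ∈ subN) : s * n * s⁻¹ ∈ subN := by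
  have : subN ≤ subN.comap (MulAut.conj s).toMonoidHom := by
    conv_lhs => rw [subN]
    rw [Subgroup.closure_le]
    intro x hx
    exact h x hx
  exact this hn

lemma subN_mems : a12 ∈ subN ∧ a13 ∈ subN ∧ a23 ∈ subN ∧ b12 ∈ subN ∧ b13 ∈ subN ∧ b23 ∈ subN := by
  refine ⟨?_, ?_, ?_, ?_, ?_, ?_⟩ <;> exact Subgroup.subset_closure (by simp)

lemma subN_conj1 (n : SG3) (hn : n ∈ subN) : σ1 * n * σ1⁻¹ ∈ subN := by
  obtain ⟨m1, m2, m3, m4, m5, m6⟩ := subN_mems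
  refine subN_conj σ1 ?_ n hn
  rintro x (rfl | rfl | rfl | rfl | rfl | rfl)
  · have : σ1 * a12 * σ1⁻¹ = a12 := by simp only [a12]; group
    rwa [this]
  · have : σ1 * a13 * σ1⁻¹ = a23 := by rw [a23_eq]; simp only [a13, a12, pow_two, mul_inv_rev, mul_assoc, inv_mul_cancel_left,
        mul_inv_cancel_left, mul_inv_cancel, inv_mul_cancel, mul_one, inv_inv]
    rwa [this]
  · have : σ1 * a23 * σ1⁻¹ = a12 * a13 * a12⁻¹ := by rw [a23_eq]; simp only [a13, a12, pow_two, mul_inv_rev, mul_assoc, inv_mul_cancel_left,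
        mul_inv_cancel_left, mul_inv_cancel, inv_mul_cancel, mul_one, inv_inv]
    rw [this]
    exact mul_mem (mul_mem m1 m2) (inv_mem m1)
  · have : σ1 * b12 * σ1⁻¹ = b12 := by
      simp only [b12]; nth_rw 1 [sg_r1]; group
    rwa [this]
  · have : σ1 * b13 * σ1⁻¹ = b23 := by rw [b23_eq]; simp only [b13, b12]; group
    rwa [this]
  · have : σ1 * b23 * σ1⁻¹ = a12 * b13 * a12⁻¹ := by
      rw [b23_eq]; simp only [b13, b12, a12, pow_two, mul_inv_rev, mul_assoc, inv_mul_cancel_left,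
        mul_inv_cancel_left, mul_inv_cancel, inv_mul_cancel, mul_one, inv_inv]
    rw [this]
    exact mul_mem (mul_mem m1 m5) (inv_mem m1)

lemma subN_conj2 (n : SG3) (hn : n ∈ subN) : σ2 * n * σ2⁻¹ ∈ subN := by
  obtain ⟨m1, m2, m3, m4, m5, m6⟩ := subN_mems
  refine subN_conj σ2 ?_ n hn
  rintro x (rfl | rfl | rfl | rfl | rfl | rfl)
  · exact m2
  · have : σ2 * a13 * σ2⁻¹ = a23 * a12 * a23⁻¹ := by simp only [a13, a12, a23, pow_two, mul_inv_rev, mul_assoc, inv_mul_cancel_left,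
        mul_inv_cancel_left, mul_inv_cancel, inv_mul_cancel, mul_one, inv_inv]
    rw [this]
    exact mul_mem (mul_mem m3 m1) (inv_mem m3)
  · have : σ2 * a23 * σ2⁻¹ = a23 := by simp only [a23]; group
    rwa [this]
  · have : σ2 * b12 * σ2⁻¹ = b13 := by simp only [b12, b13]; group
    rwa [this]
  · have : σ2 * b13 * σ2⁻¹ = a23 * b12 * a23⁻¹ := by simp only [b13, b12, a23, pow_two, mul_inv_rev, mul_assoc, inv_mul_cancel_left,
        mul_inv_cancel_left, mul_inv_cancel, inv_mul_cancel, mul_one, inv_inv]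
    rw [this]
    exact mul_mem (mul_mem m3 m4) (inv_mem m3)
  · have : σ2 * b23 * σ2⁻¹ = b23 := by
      simp only [b23]; nth_rw 1 [sg_r2]; group
    rwa [this]

lemma subN_normal : subN.Normal := by
  obtain ⟨m1, m2, m3, m4, m5, m6⟩ := subN_mems
  have hs1 : σ1 ∈ Subgroup.normalizer (subN : Set SG3) := by
    rw [Subgroup.mem_normalizer_iff]
    intro n
    refine ⟨subN_conj1 n, fun h => ?_⟩
    have h2 := subN_conj1 _ h
    have : n = a12⁻¹ * (σ1 * (σ1 * n * σ1⁻¹) * σ1⁻¹) * a12 := by simp only [a12]; group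
    rw [this]
    exact mul_mem (mul_mem (inv_mem m1) h2) m1
  have hs2 : σ2 ∈ Subgroup.normalizer (subN : Set SG3) := by
    rw [Subgroup.mem_normalizer_iff]
    intro n
    refine ⟨subN_conj2 n, fun h => ?_⟩
    have h2 := subN_conj2 _ h
    have : n = a23⁻¹ * (σ2 * (σ2 * n * σ2⁻¹) * σ2⁻¹) * a23 := by simp only [a23]; group
    rw [this]
    exact mul_mem (mul_mem (inv_mem m3) h2) m3
  have hle := Subgroup.le_normalizer (H := subN)
  have ht1 : τ1 ∈ Subgroup.normalizer (subN : Set SG3) := by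
    have : τ1 = σ1⁻¹ * b12 := by simp only [b12]; group
    rw [this]; exact mul_mem (inv_mem hs1) (hle m4)
  have ht2 : τ2 ∈ Subgroup.normalizer (subN : Set SG3) := by
    have : τ2 = σ2⁻¹ * b23 := by simp only [b23]; group
    rw [this]; exact mul_mem (inv_mem hs2) (hle m6)
  rw [← Subgroup.normalizer_eq_top_iff, eq_top_iff]
  intro g _
  exact sg_top_le _ hs1 hs2 ht1 ht2 g

/-- Six elements stable under left multiplication by two involutions with the braid relation. -/
lemma six_step {Q : Type*} [Group Q] {p q : Q} (hp : p * p = 1) (hq : q * q = 1)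
    (hb : p * q * p = q * p * q) (x : Q)
    (hx : x = 1 ∨ x = p ∨ x = q ∨ x = p * q ∨ x = q * p ∨ x = p * q * p) :
    (p * x = 1 ∨ p * x = p ∨ p * x = q ∨ p * x = p * q ∨ p * x = q * p ∨ p * x = p * q * p) ∧
    (q * x = 1 ∨ q * x = p ∨ q * x = q ∨ q * x = p * q ∨ q * x = q * p ∨ q * x = p * q * p) := by
  have hp' : ∀ y, p * (p * y) = y := fun y => by rw [← mul_assoc, hp, one_mul]
  have hq' : ∀ y, q * (q * y) = y := fun y => by rw [← mul_assoc, hq, one_mul]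
  rcases hx with rfl | rfl | rfl | rfl | rfl | rfl
  · simp
  · simp [hp]
  · simp [hq]
  · refine ⟨?_, ?_⟩
    · simp [hp']
    · rw [← mul_assoc, ← hb]; simp
  · refine ⟨?_, ?_⟩
    · rw [← mul_assoc]; simp
    · simp [hq']
  · refine ⟨?_, ?_⟩
    · rw [mul_assoc, hp']; simp
    · rw [hb, mul_assoc, hq']; simp

lemma coset_reps (g : SG3) : ∃ x : SG3, (x = 1 ∨ x = σ1 ∨ x = σ2 ∨ x = σ1 * σ2 ∨ x = σ2 * σ1 ∨
    x = σ1 * σ2 * σ1) ∧ g⁻¹ * x ∈ subN := by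
  obtain ⟨m1, m2, m3, m4, m5, m6⟩ := subN_mems
  have := subN_normal
  let q := QuotientGroup.mk' subN
  have hp : q σ1 * q σ1 = 1 := by
    rw [← map_mul]
    refine (QuotientGroup.eq_one_iff _).2 ?_
    rw [← pow_two]; exact m1
  have hq : q σ2 * q σ2 = 1 := by
    rw [← map_mul]
    refine (QuotientGroup.eq_one_iff _).2 ?_
    rw [← pow_two]; exact m3
  have hb : q σ1 * q σ2 * q σ1 = q σ2 * q σ1 * q σ2 := by
    simp only [← map_mul, sg_r3]
  have ht1 : q τ1 = q σ1 := by
    have : q σ1 * q τ1 = 1 := by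
      rw [← map_mul]; exact (QuotientGroup.eq_one_iff _).2 m4
    rw [← hp] at this
    exact mul_left_cancel this
  have ht2 : q τ2 = q σ2 := by
    have : q σ2 * q τ2 = 1 := by
      rw [← map_mul]; exact (QuotientGroup.eq_one_iff _).2 m6
    rw [← hq] at this
    exact mul_left_cancel this
  have key : ∀ g : SG3, ∀ x : SG3 ⧸ subN, (x = 1 ∨ x = q σ1 ∨ x = q σ2 ∨ x = q σ1 * q σ2 ∨
      x = q σ2 * q σ1 ∨ x = q σ1 * q σ2 * q σ1) → (q g * x = 1 ∨ q g * x = q σ1 ∨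
      q g * x = q σ2 ∨ q g * x = q σ1 * q σ2 ∨
      q g * x = q σ2 * q σ1 ∨ q g * x = q σ1 * q σ2 * q σ1) := by
    intro g
    have hg : g ∈ Subgroup.closure (Set.range (PresentedGroup.of (rels := sg3Rels))) := by
      rw [PresentedGroup.closure_range_of]; trivial
    have gen : ∀ j : Fin 4, q (PresentedGroup.of j) = q σ1 ∨ q (PresentedGroup.of j) = q σ2 := by
      intro j
      fin_cases j
      exacts [Or.inl rfl, Or.inr rfl, Or.inl ht1, Or.inr ht2]
    have hinv : ∀ y : SG3 ⧸ subN, y * y = 1 → y⁻¹ = y := fun y h => inv_eq_of_mul_eq_one_left h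
    induction hg using Subgroup.closure_induction'' with
    | mem y hy =>
      obtain ⟨j, rfl⟩ := hy
      intro x hx
      rcases gen j with h | h <;> rw [h]
      exacts [(six_step hp hq hb x hx).1, (six_step hp hq hb x hx).2]
    | inv_mem y hy =>
      obtain ⟨j, rfl⟩ := hy
      intro x hx
      rw [map_inv]
      rcases gen j with h | h <;> rw [h]
      · rw [hinv _ hp]; exact (six_step hp hq hb x hx).1
      · rw [hinv _ hq]; exact (six_step hp hq hb x hx).2
    | one => intro x hx; simpa using hx
    | mul y z _ _ hy hz =>
      intro x hx
      rw [map_mul, mul_assoc]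
      exact hy _ (hz _ hx)
  have hfin := key g 1 (Or.inl rfl)
  rw [mul_one] at hfin
  simp only [← map_mul, ← map_one q] at hfin
  rcases hfin with h | h | h | h | h | h
  · exact ⟨1, by simp, QuotientGroup.eq.1 h⟩
  · exact ⟨σ1, by simp, QuotientGroup.eq.1 h⟩
  · exact ⟨σ2, by simp, QuotientGroup.eq.1 h⟩
  · exact ⟨σ1 * σ2, by simp, QuotientGroup.eq.1 h⟩
  · exact ⟨σ2 * σ1, by simp, QuotientGroup.eq.1 h⟩
  · exact ⟨σ1 * σ2 * σ1, by simp, QuotientGroup.eq.1 h⟩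

lemma subN_eq_ker (π : SG3 →* Equiv.Perm (Fin 3))
    (hσ1 : π σ1 = Equiv.swap 0 1) (hτ1 : π τ1 = Equiv.swap 0 1)
    (hσ2 : π σ2 = Equiv.swap 1 2) (hτ2 : π τ2 = Equiv.swap 1 2) : subN = MonoidHom.ker π := by
  have hle : subN ≤ MonoidHom.ker π := by
    rw [subN, Subgroup.closure_le]
    rintro x (rfl | rfl | rfl | rfl | rfl | rfl) <;>
      simp [MonoidHom.mem_ker, a12, a13, a23, b12, b13, b23, hσ1, hσ2, hτ1, hτ2, pow_two]
  refine le_antisymm hle ?_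
  intro g hg
  obtain ⟨x, hx, hgx⟩ := coset_reps g
  have hpx : π x = 1 := by
    have h := MonoidHom.mem_ker.1 (hle hgx)
    rwa [map_mul, map_inv, MonoidHom.mem_ker.1 hg, inv_one, one_mul] at h
  rcases hx with rfl | rfl | rfl | rfl | rfl | rfl
  · simpa using hgx
  all_goals
    exfalso
    simp only [map_mul, hσ1, hσ2] at hpx
    revert hpx
    decide

lemma sup_eq_subN : Subgroup.zpowers (a12 * a13 * a23) ⊔
      Subgroup.closure {a13, a23, b13, b23, b12} = subN := by
  obtain ⟨m1, m2, m3, m4, m5, m6⟩ := subN_mems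
  apply le_antisymm
  · refine sup_le ?_ ?_
    · rw [Subgroup.zpowers_le]
      exact mul_mem (mul_mem m1 m2) m3
    · rw [Subgroup.closure_le]
      rintro x (rfl | rfl | rfl | rfl | rfl) <;> assumption
  · have hV : ∀ x ∈ ({a13, a23, b13, b23, b12} : Set SG3), x ∈ Subgroup.zpowers (a12 * a13 * a23) ⊔
        Subgroup.closure {a13, a23, b13, b23, b12} :=
      fun x hx => (le_sup_right : _ ≤ Subgroup.zpowers (a12 * a13 * a23) ⊔ _)
        (Subgroup.subset_closure hx)
    rw [subN, Subgroup.closure_le]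
    rintro x (rfl | rfl | rfl | rfl | rfl | rfl)
    · have e : a12 = (a12 * a13 * a23) * a23⁻¹ * a13⁻¹ := by group
      rw [SetLike.mem_coe]
      have hz : a12 * a13 * a23 ∈ Subgroup.zpowers (a12 * a13 * a23) ⊔
        Subgroup.closure {a13, a23, b13, b23, b12} :=
        (le_sup_left : Subgroup.zpowers (a12 * a13 * a23) ≤ _) (Subgroup.mem_zpowers _)
      have := mul_mem (mul_mem hz (inv_mem (hV a23 (by simp)))) (inv_mem (hV a13 (by simp)))
      rwa [← e] at this
    all_goals exact hV _ (by simp)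

/-- The cyclic subgroup generated by `δ = a₁₂a₁₃a₂₃` is exactly the center of
`SP₃ = ker π`, it intersects `Ṽ₃ = ⟨a₁₃, a₂₃, b₁₃, b₂₃, b₁₂⟩` trivially, together
with `Ṽ₃` it generates `SP₃`, and `SP₃ ≅ ℤ × Ṽ₃`. -/
theorem stmt15 (π : SG3 →* Equiv.Perm (Fin 3))
    (hσ1 : π σ1 = Equiv.swap 0 1) (hτ1 : π τ1 = Equiv.swap 0 1)
    (hσ2 : π σ2 = Equiv.swap 1 2) (hτ2 : π τ2 = Equiv.swap 1 2) :
    (∀ g : SG3, g ∈ Subgroup.zpowers (a12 * a13 * a23) ↔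
      (g ∈ MonoidHom.ker π ∧ ∀ h ∈ MonoidHom.ker π, g * h = h * g)) ∧
    Subgroup.zpowers (a12 * a13 * a23) ⊓
      Subgroup.closure {a13, a23, b13, b23, b12} = ⊥ ∧
    Subgroup.zpowers (a12 * a13 * a23) ⊔
      Subgroup.closure {a13, a23, b13, b23, b12} = MonoidHom.ker π ∧
    Nonempty (MonoidHom.ker π ≃*
      Multiplicative ℤ × Subgroup.closure {a13, a23, b13, b23, b12}) := by
  have hker := subN_eq_ker π hσ1 hτ1 hσ2 hτ2
  have hsup := sup_eq_subN.trans hker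
  have hinf : Subgroup.zpowers (a12 * a13 * a23) ⊓
      Subgroup.closure {a13, a23, b13, b23, b12} = ⊥ := by
    rw [eq_bot_iff]
    rintro g ⟨⟨n, rfl⟩, h2⟩
    have : n = 0 := linking_trivial n h2
    simp [this]
  obtain ⟨m1, m2, m3, m4, m5, m6⟩ := subN_mems
  refine ⟨?_, hinf, hsup, ?_⟩
  · intro g
    constructor
    · intro hg
      refine ⟨hsup ▸ (le_sup_left : Subgroup.zpowers (a12 * a13 * a23) ≤ _) hg, ?_⟩
      obtain ⟨n, rfl⟩ := hg
      intro h _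
      have : Commute (a12 * a13 * a23) h := delta_central h
      exact (this.zpow_left n).eq
    · rintro ⟨_, hc⟩
      exact central_mem_zpowers g (hc _ (hker ▸ m4)).symm (hc _ (hker ▸ m3)).symm
  · let V := Subgroup.closure {a13, a23, b13, b23, b12}
    let f : Multiplicative ℤ →* SG3 := zpowersHom SG3 (a12 * a13 * a23)
    have hf : f.range = Subgroup.zpowers (a12 * a13 * a23) := by
      ext y; simp [f, Subgroup.mem_zpowers_iff, MonoidHom.mem_range]
    have hcomm : ∀ (m : Multiplicative ℤ) (v : V), Commute (f m) (V.subtype v) := by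
      intro m v
      have : Commute (a12 * a13 * a23) (V.subtype v) := delta_central _
      exact this.zpow_left _
    have hinj : Function.Injective (f.noncommCoprod V.subtype hcomm) := by
      rw [MonoidHom.noncommCoprod_injective]
      refine ⟨?_, V.subtype_injective, ?_⟩
      · rw [injective_iff_map_eq_one]
        intro m hm
        have h0 : (a12 * a13 * a23) ^ (Multiplicative.toAdd m) = 1 := hm
        have := linking_trivial (Multiplicative.toAdd m) (by rw [h0]; exact one_mem _)
        exact this
      · rw [hf, Subgroup.range_subtype, disjoint_iff]
        exact hinf
    have hrange : (f.noncommCoprod V.subtype hcomm).range = MonoidHom.ker π := by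
      rw [MonoidHom.noncommCoprod_range, hf, Subgroup.range_subtype]
      exact hsup
    exact ⟨((MonoidHom.ofInjective hinj).trans (MulEquiv.subgroupCongr hrange)).symm⟩
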